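/- Global convergence of discrete-space CACTO (main theorem): in the CACTO iteration starting from an arbitrary initial policy π⁰ with any TO-operator, the sequence of value functions converges to the optimal value function; more precisely, there exists K ∈ ℕ such that for all k ≥ K, V^{TO(π^k)}_t(x) = V*_t(x) for all t and x, and for all k > K the policy π^k is optimal, i.e., V^{π^k}_t(x) = V*_t(x) for all t and x. -/

import Mathlib

/-- Value function of a policy `π`, defined by backward recursion:
`V^π_T(x) = lT x` and for `t < T`,
`V^π_t(x) = l t x (π t x) + V^π_{t+1}(f t x (π t x))`. -/
def val {S U : Type*} (T : ℕ) (f : Fin T → S → U → S) (l : Fin T → S → U → ℝ)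
    (lT : S → ℝ) (π : Fin T → S → U) : Fin (T + 1) → S → ℝ
  | t, x =>
    if h : (t : ℕ) < T then
      l ⟨t, h⟩ x (π ⟨t, h⟩ x) +
        val T f l lT π ⟨(t : ℕ) + 1, by omega⟩ (f ⟨t, h⟩ x (π ⟨t, h⟩ x))
    else lT x
  termination_by t _ => T - (t : ℕ)
  decreasing_by omega

/-- `π'` is greedy with respect to `W`. -/
def IsGreedy {S U : Type*} (T : ℕ) (f : Fin T → S → U → S) (l : Fin T → S → U → ℝ)
    (π' : Fin T → S → U) (W : Fin (T + 1) → S → ℝ) : Prop :=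
  ∀ (t : Fin T) (x : S) (u : U),
    l t x (π' t x) + W t.succ (f t x (π' t x)) ≤ l t x u + W t.succ (f t x u)

/-- The optimal value function: pointwise minimum of `val` over all (finitely many) policies. -/
noncomputable def optVal {S U : Type*} [Fintype S] [DecidableEq S] [Fintype U] [Nonempty U]
    (T : ℕ) (f : Fin T → S → U → S) (l : Fin T → S → U → ℝ) (lT : S → ℝ) :
    Fin (T + 1) → S → ℝ :=
  fun t x =>
    Finset.univ.inf' Finset.univ_nonempty (fun π : Fin T → S → U => val T f l lT π t x)

section PolicyImprovement

variable {S U : Type*} {T : ℕ} {f : Fin T → S → U → S} {l : Fin T → S → U → ℝ} {lT : S → ℝ}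

theorem val_last (p : Fin T → S → U) (x : S) : val T f l lT p (Fin.last T) x = lT x := by
  rw [val]
  simp

theorem val_castSucc (p : Fin T → S → U) (t : Fin T) (x : S) :
    val T f l lT p t.castSucc x = l t x (p t x) + val T f l lT p t.succ (f t x (p t x)) := by
  rw [val]
  simp [Fin.succ]

/-- Policy improvement: a policy greedy with respect to the value of `r` is at least as good
as `r`. -/
theorem IsGreedy.val_le {q r : Fin T → S → U} (hq : IsGreedy T f l q (val T f l lT r))
    (t : Fin (T + 1)) (x : S) : val T f l lT q t x ≤ val T f l lT r t x := by
  induction t using Fin.reverseInduction generalizing x with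
  | last => rw [val_last, val_last]
  | cast t ih =>
    rw [val_castSucc, val_castSucc]
    exact (add_le_add_right (ih _) _).trans (hq t x (r t x))

/-- If `r` is optimal from time `t + 1` on, a policy greedy with respect to its value is optimal
at time `t`. -/
theorem IsGreedy.val_castSucc_le {q r : Fin T → S → U}
    (hq : IsGreedy T f l q (val T f l lT r)) {t : Fin T} {p : Fin T → S → U}
    (hr : ∀ y, val T f l lT r t.succ y ≤ val T f l lT p t.succ y) (x : S) :
    val T f l lT q t.castSucc x ≤ val T f l lT p t.castSucc x := by
  rw [val_castSucc, val_castSucc]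
  exact (add_le_add_right (hq.val_le _ _) _).trans
    ((hq t x (p t x)).trans (add_le_add_right (hr _) _))

/-- After `k` iterations the trajectory-optimized policy is optimal on the last `k` stages. -/
theorem val_trajectoryOpt_le {TO : (Fin T → S → U) → (Fin T → S → U)}
    (hTO : ∀ p t x, val T f l lT (TO p) t x ≤ val T f l lT p t x)
    {π : ℕ → Fin T → S → U}
    (hgreedy : ∀ k, IsGreedy T f l (π (k + 1)) (val T f l lT (TO (π k))))
    (p : Fin T → S → U) (k : ℕ) (t : Fin (T + 1)) (ht : T ≤ t + k) (x : S) :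
    val T f l lT (TO (π k)) t x ≤ val T f l lT p t x := by
  induction k generalizing t x with
  | zero =>
    obtain rfl : t = Fin.last T := Fin.ext (by simp only [Fin.val_last]; omega)
    rw [val_last, val_last]
  | succ k ih =>
    cases t using Fin.lastCases with
    | last => rw [val_last, val_last]
    | cast t =>
      refine (hTO _ _ _).trans ((hgreedy k).val_castSucc_le (fun y => ih _ ?_ y) x)
      simp only [Fin.val_castSucc, Fin.val_succ] at ht ⊢
      omega

theorem val_eq_optVal [Fintype S] [DecidableEq S] [Fintype U] [Nonempty U]
    {q : Fin T → S → U} {t : Fin (T + 1)} {x : S}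
    (h : ∀ p, val T f l lT q t x ≤ val T f l lT p t x) :
    val T f l lT q t x = optVal T f l lT t x :=
  le_antisymm (Finset.le_inf' _ _ fun p _ => h p) (Finset.inf'_le _ (Finset.mem_univ q))

end PolicyImprovement

variable {S U : Type*} [Fintype S] [DecidableEq S] [Nonempty S] [Fintype U] [Nonempty U]
  (T : ℕ) (f : Fin T → S → U → S) (l : Fin T → S → U → ℝ) (lT : S → ℝ)

theorem cacto_global_convergence
    (TO : (Fin T → S → U) → (Fin T → S → U))
    (hTO : ∀ (p : Fin T → S → U) (t : Fin (T + 1)) (x : S),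
      val T f l lT (TO p) t x ≤ val T f l lT p t x)
    (π : ℕ → Fin T → S → U)
    (hgreedy : ∀ k : ℕ, IsGreedy T f l (π (k + 1)) (val T f l lT (TO (π k)))) :
    ∃ K : ℕ,
      (∀ k ≥ K, ∀ (t : Fin (T + 1)) (x : S),
        val T f l lT (TO (π k)) t x = optVal T f l lT t x) ∧
      ∀ k > K, ∀ (t : Fin (T + 1)) (x : S),
        val T f l lT (π k) t x = optVal T f l lT t x := by
  have hopt (k : ℕ) (hk : T ≤ k) (p : Fin T → S → U) (t : Fin (T + 1)) (x : S) :
      val T f l lT (TO (π k)) t x ≤ val T f l lT p t x :=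
    val_trajectoryOpt_le hTO hgreedy p k t (by omega) x
  refine ⟨T, fun k hk t x => val_eq_optVal fun p => hopt k hk p t x, fun k hk t x => ?_⟩
  obtain ⟨k, rfl⟩ := Nat.exists_eq_add_one_of_ne_zero (by omega : k ≠ 0)
  exact val_eq_optVal fun p => ((hgreedy k).val_le t x).trans (hopt k (by omega) p t x)
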